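/- Let β ∈ ℂ be a root of 8x⁴ + 14x³ − 11x² − 11x − 2 and let K = ℚ(β). Set b₂ = −(6901/1024)β³ − (41387/4096)β² + (91011/8192)β + 39449/8192 and c₂ = −(139/16)β³ − (725/64)β² + (2301/128)β + 871/128, and let W be the Tate normal form E(b₂,c₂): y² + (1−c₂)xy − b₂y = x³ − b₂x² over K. Then the torsion subgroup of the group of K-rational points of W is isomorphic to ℤ/17ℤ; thus W is an elliptic curve over a cyclic quartic number field with torsion subgroup ℤ/17ℤ. -/

import Mathlib

open scoped IntermediateField

section FormalGroup

variable {F : Type*} [Field F] {v : AbsoluteValue F ℝ}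

lemma IsNonarchimedean.map_add_le_of_le (hv : IsNonarchimedean v) {x y : F} {a : ℝ}
    (hx : v x ≤ a) (hy : v y ≤ a) : v (x + y) ≤ a :=
  (hv x y).trans (max_le hx hy)

lemma IsNonarchimedean.map_sub_le_of_le (hv : IsNonarchimedean v) {x y : F} {a : ℝ}
    (hx : v x ≤ a) (hy : v y ≤ a) : v (x - y) ≤ a := by
  rw [sub_eq_add_neg]
  exact hv.map_add_le_of_le hx (by rwa [v.map_neg])

lemma AbsoluteValue.map_mul_le_of_le {x y : F} {a b : ℝ}
    (hx : v x ≤ a) (hy : v y ≤ b) : v (x * y) ≤ a * b := by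
  rw [v.map_mul]
  exact mul_le_mul hx hy (v.nonneg _) ((v.nonneg _).trans hx)

lemma AbsoluteValue.map_mul_le_of_le_one {x y : F} {b : ℝ}
    (hx : v x ≤ 1) (hy : v y ≤ b) : v (x * y) ≤ b := by
  simpa using v.map_mul_le_of_le hx hy

lemma IsNonarchimedean.map_add_eq_left (hv : IsNonarchimedean v) {x y : F}
    (h : v y < v x) : v (x + y) = v x := by
  refine le_antisymm (hv.map_add_le_of_le le_rfl h.le) ?_
  by_contra! hlt
  have := hv (x + y) (-y)
  rw [v.map_neg, add_neg_cancel_right] at this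
  exact absurd this (not_le.2 (max_lt hlt h))

lemma IsNonarchimedean.map_ofNat_le_one (hv : IsNonarchimedean v) (n : ℕ) [n.AtLeastTwo] :
    v (OfNat.ofNat n : F) ≤ 1 := by
  have := hv.apply_natCast_le_one (n := OfNat.ofNat n)
  rwa [Nat.cast_ofNat] at this

/-- A line `L t + M s = 1` meeting the curve `s = 4 t³ + b₂ t² s + 2 b₄ t s² + b₆ s³` near the
origin has `L` small compared to `M`. -/
lemma chord_bound (hv : IsNonarchimedean v) {b₂ b₄ b₆ t₁ s₁ t₂ s₂ L M : F} {r : ℝ}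
    (hb₂ : v b₂ ≤ 1) (hb₄ : v b₄ ≤ 1) (hb₆ : v b₆ ≤ 1) (hr : r < 1)
    (ht₁ : v t₁ ≤ r) (ht₂ : v t₂ ≤ r) (hs₁ : v s₁ ≤ r ^ 3) (hs₂ : v s₂ ≤ r ^ 3)
    (h₁ : s₁ = 4 * t₁ ^ 3 + b₂ * t₁ ^ 2 * s₁ + 2 * b₄ * t₁ * s₁ ^ 2 + b₆ * s₁ ^ 3)
    (h₂ : s₂ = 4 * t₂ ^ 3 + b₂ * t₂ ^ 2 * s₂ + 2 * b₄ * t₂ * s₂ ^ 2 + b₆ * s₂ ^ 3)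
    (hL₁ : L * t₁ + M * s₁ = 1) (hL₂ : L * t₂ + M * s₂ = 1)
    (htan : t₁ = t₂ → s₁ = s₂ → L * (1 - b₂ * t₁ ^ 2 - 4 * b₄ * t₁ * s₁ - 3 * b₆ * s₁ ^ 2) =
      - M * (12 * t₁ ^ 2 + 2 * b₂ * t₁ * s₁ + 2 * b₄ * s₁ ^ 2)) :
    M ≠ 0 ∧ v (L / M) ≤ r ^ 2 ∧ v (1 / M) ≤ r ^ 3 := by
  have hr0 : 0 ≤ r := (v.nonneg _).trans ht₁
  have hr31 : r ^ 3 ≤ r := by nlinarith [mul_nonneg hr0 hr0]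
  have hs₁' := hs₁.trans hr31
  have hs₂' := hs₂.trans hr31
  have hn2 := hv.map_ofNat_le_one 2
  have hn4 := hv.map_ofNat_le_one 4
  have hU : v (-(b₂ * (t₂ * t₂) + (2 * b₄) * (t₂ * (s₁ + s₂)) +
      b₆ * (s₁ * s₁ + s₁ * s₂ + s₂ * s₂))) ≤ r * r := by
    rw [v.map_neg]
    refine hv.map_add_le_of_le (hv.map_add_le_of_le ?_ ?_) ?_
    · exact v.map_mul_le_of_le_one hb₂ (v.map_mul_le_of_le ht₂ ht₂)
    · exact v.map_mul_le_of_le_one (v.map_mul_le_of_le_one hn2 hb₄)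
        (v.map_mul_le_of_le ht₂ (hv.map_add_le_of_le hs₁' hs₂'))
    · exact v.map_mul_le_of_le_one hb₆ (hv.map_add_le_of_le (hv.map_add_le_of_le
        (v.map_mul_le_of_le hs₁' hs₁') (v.map_mul_le_of_le hs₁' hs₂'))
        (v.map_mul_le_of_le hs₂' hs₂'))
  set U := 1 + -(b₂ * (t₂ * t₂) + (2 * b₄) * (t₂ * (s₁ + s₂)) +
      b₆ * (s₁ * s₁ + s₁ * s₂ + s₂ * s₂)) with hUdef
  have hU1 : v U = 1 := by
    rw [hUdef, hv.map_add_eq_left, v.map_one]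
    rw [v.map_one]; nlinarith
  have hU0 : U ≠ 0 := by
    intro h; rw [h, v.map_zero] at hU1; exact zero_ne_one hU1
  set V := 4 * (t₁ * t₁ + t₁ * t₂ + t₂ * t₂) + b₂ * ((t₁ + t₂) * s₁) + (2 * b₄) * (s₁ * s₁)
    with hVdef
  have hV : v V ≤ r * r := by
    refine hv.map_add_le_of_le (hv.map_add_le_of_le ?_ ?_) ?_
    · exact v.map_mul_le_of_le_one hn4 (hv.map_add_le_of_le (hv.map_add_le_of_le
        (v.map_mul_le_of_le ht₁ ht₁) (v.map_mul_le_of_le ht₁ ht₂))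
        (v.map_mul_le_of_le ht₂ ht₂))
    · exact v.map_mul_le_of_le_one hb₂ (v.map_mul_le_of_le (hv.map_add_le_of_le ht₁ ht₂) hs₁')
    · exact v.map_mul_le_of_le_one (v.map_mul_le_of_le_one hn2 hb₄)
        (v.map_mul_le_of_le hs₁' hs₁')
  have hUV : U * (s₁ - s₂) = V * (t₁ - t₂) := by
    rw [hUdef, hVdef]; linear_combination h₁ - h₂
  have hLU : L * U = - M * V := by
    by_cases ht : t₁ = t₂
    · have hs : s₁ = s₂ := by
        rw [ht, sub_self, mul_zero] at hUV
        exact sub_eq_zero.1 ((mul_eq_zero.1 hUV).resolve_left hU0)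
      have := htan ht hs
      rw [hUdef, hVdef, ← ht, ← hs]
      linear_combination this
    · apply mul_right_cancel₀ (sub_ne_zero.2 ht)
      linear_combination U * (hL₁ - hL₂) - M * hUV
  have hM : M ≠ 0 := by
    rintro rfl
    rw [neg_zero, zero_mul] at hLU
    rw [(mul_eq_zero.1 hLU).resolve_right hU0] at hL₁
    simp at hL₁
  have hLM : v (L / M) ≤ r ^ 2 := by
    have : L / M = -(V / U) := by
      field_simp; linear_combination hLU
    rw [this, v.map_neg, map_div₀, hU1, div_one, sq]
    exact hV
  refine ⟨hM, hLM, ?_⟩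
  have : 1 / M = s₁ + L / M * t₁ := by
    field_simp; linear_combination -hL₁
  rw [this]
  refine hv.map_add_le_of_le hs₁ ?_
  calc v (L / M * t₁) ≤ r ^ 2 * r := v.map_mul_le_of_le hLM ht₁
    _ = r ^ 3 := by ring

/-- Three points on the line `η = L x + M` and the curve `η² = 4 x³ + b₂ x² + 2 b₄ x + b₆`: if two
of them are close to the origin, so is the third, and `x / η` is almost additive. -/
lemma third_point_bound (hv : IsNonarchimedean v) (hv2 : v 2 = 1)
    {b₂ b₄ b₆ x₁ η₁ x₂ η₂ x₃ L M : F} {r : ℝ}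
    (hb₂ : v b₂ ≤ 1) (hb₄ : v b₄ ≤ 1) (hb₆ : v b₆ ≤ 1) (hr : r < 1)
    (hη₁ : η₁ ≠ 0) (hη₂ : η₂ ≠ 0)
    (ht₁ : v (x₁ / η₁) ≤ r) (ht₂ : v (x₂ / η₂) ≤ r)
    (hs₁ : v (1 / η₁) ≤ r ^ 3) (hs₂ : v (1 / η₂) ≤ r ^ 3)
    (h₁ : η₁ ^ 2 = 4 * x₁ ^ 3 + b₂ * x₁ ^ 2 + 2 * b₄ * x₁ + b₆)
    (h₂ : η₂ ^ 2 = 4 * x₂ ^ 3 + b₂ * x₂ ^ 2 + 2 * b₄ * x₂ + b₆)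
    (hL₁ : L * x₁ + M = η₁) (hL₂ : L * x₂ + M = η₂)
    (he₁ : 4 * (x₁ + x₂ + x₃) = L ^ 2 - b₂)
    (he₂ : 4 * (x₁ * x₂ + x₁ * x₃ + x₂ * x₃) = 2 * b₄ - 2 * L * M)
    (he₃ : 4 * (x₁ * x₂ * x₃) = M ^ 2 - b₆) :
    L * x₃ + M ≠ 0 ∧ v (x₃ / (L * x₃ + M)) ≤ r ∧ v (1 / (L * x₃ + M)) ≤ r ^ 3 ∧
      v (x₁ / η₁ + x₂ / η₂ + x₃ / (L * x₃ + M)) ≤ r ^ 3 := by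
  have hr0 : 0 ≤ r := (v.nonneg _).trans ht₁
  have hr31 : r ^ 3 ≤ r := by nlinarith [mul_nonneg hr0 hr0]
  have hr21 : r ^ 2 ≤ r := by nlinarith [mul_nonneg hr0 hr0]
  have hn2 := hv.map_ofNat_le_one 2
  have hn3 := hv.map_ofNat_le_one 3
  have hn4 := hv.map_ofNat_le_one 4
  have hv4 : v 4 = 1 := by
    rw [show (4 : F) = 2 * 2 by norm_num, v.map_mul, hv2, one_mul]
  obtain ⟨hM, hLM, hM1⟩ := chord_bound (L := L) (M := M) hv hb₂ hb₄ hb₆ hr ht₁ ht₂ hs₁ hs₂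
    (by field_simp; linear_combination h₁) (by field_simp; linear_combination h₂)
    (by field_simp; linear_combination hL₁) (by field_simp; linear_combination hL₂) (by
      intro ht hs
      have hη : η₁ = η₂ := by simpa using hs
      have hx : x₁ = x₂ := by
        rw [hη] at ht; field_simp at ht; exact ht
      subst hx hη
      subst hL₁
      field_simp
      have key : 2 * L * (L * x₁ + M) = 12 * x₁ ^ 2 + 2 * b₂ * x₁ + 2 * b₄ := by
        linear_combination he₂ - 2 * x₁ * he₁
      linear_combination (-L * x₁ - M) * key + 3 * L * h₁)
  set α := L / M with hα
  have hLα : L = α * M := by rw [hα]; field_simp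
  set γ := 1 / M with hγ
  have hγM : γ * M = 1 := by rw [hγ]; field_simp
  set u := (-b₂ * α + 2 * b₄ * (α * α) - b₆ * (α * (α * α))) with hu
  have hα1 : v α ≤ 1 := by nlinarith
  have hαr : v α ≤ r := hLM.trans hr21
  have hur : v u ≤ r := by
    rw [hu]
    refine hv.map_sub_le_of_le (hv.map_add_le_of_le ?_ ?_) ?_
    · exact v.map_mul_le_of_le_one (by rwa [v.map_neg]) hαr
    · exact v.map_mul_le_of_le_one (v.map_mul_le_of_le_one hn2 hb₄)
        (v.map_mul_le_of_le_one hα1 hαr)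
    · exact v.map_mul_le_of_le_one hb₆ (v.map_mul_le_of_le_one hα1
        (v.map_mul_le_of_le_one hα1 hαr))
  have hD : v (4 + u) = 1 := by
    rw [hv.map_add_eq_left, hv4]; rw [hv4]; exact hur.trans_lt hr
  have hD0 : 4 + u ≠ 0 := by
    intro h; rw [h, v.map_zero] at hD; exact zero_ne_one hD
  have hprod : 4 * (η₁ * η₂ * (L * x₃ + M)) = M ^ 3 * (4 + u) := by
    rw [hu, ← hL₁, ← hL₂, hLα]
    rw [hLα] at he₁ he₂
    linear_combination (α * M) ^ 3 * he₃ + (α * M) ^ 2 * M * he₂ + (α * M) * M ^ 2 * he₁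
  have hη₃ : L * x₃ + M ≠ 0 := by
    intro h
    rw [h, mul_zero, mul_zero] at hprod
    exact mul_ne_zero (pow_ne_zero 3 hM) hD0 hprod.symm
  have hsum : x₁ / η₁ + x₂ / η₂ + x₃ / (L * x₃ + M) =
      γ * (-b₂ + 4 * (b₄ * α) - 3 * (b₆ * (α * α))) / (4 + u) := by
    rw [eq_div_iff hD0]
    apply mul_right_cancel₀ (pow_ne_zero 3 hM)
    rw [mul_assoc, mul_comm (4 + u), ← hprod]
    have : (x₁ / η₁ + x₂ / η₂ + x₃ / (L * x₃ + M)) * (4 * (η₁ * η₂ * (L * x₃ + M))) =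
        4 * (x₁ * η₂ * (L * x₃ + M) + x₂ * η₁ * (L * x₃ + M) + x₃ * η₁ * η₂) := by
      generalize L * x₃ + M = η₃ at hη₃
      field_simp
    rw [this, ← hL₁, ← hL₂, hLα]
    rw [hLα] at he₁ he₂
    linear_combination 3 * (α * M) ^ 2 * he₃ + 2 * (α * M) * M * he₂ + M ^ 2 * he₁ -
      M ^ 2 * (-b₂ + 4 * (b₄ * α) - 3 * (b₆ * (α * α))) * hγM
  have hsumv : v (x₁ / η₁ + x₂ / η₂ + x₃ / (L * x₃ + M)) ≤ r ^ 3 := by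
    rw [hsum, map_div₀, hD, div_one, mul_comm γ]
    refine v.map_mul_le_of_le_one ?_ hM1
    refine hv.map_sub_le_of_le (hv.map_add_le_of_le (by rwa [v.map_neg]) ?_) ?_
    · exact v.map_mul_le_of_le_one hn4 (v.map_mul_le_of_le_one hb₄ hα1)
    · exact v.map_mul_le_of_le_one hn3 (v.map_mul_le_of_le_one hb₆
        (v.map_mul_le_of_le_one hα1 hα1))
  have ht₃ : v (x₃ / (L * x₃ + M)) ≤ r := by
    rw [show x₃ / (L * x₃ + M) = (x₁ / η₁ + x₂ / η₂ + x₃ / (L * x₃ + M)) -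
      (x₁ / η₁ + x₂ / η₂) by ring]
    exact hv.map_sub_le_of_le (hsumv.trans hr31) (hv.map_add_le_of_le ht₁ ht₂)
  refine ⟨hη₃, ht₃, ?_, hsumv⟩
  rw [show 1 / (L * x₃ + M) = γ - α * (x₃ / (L * x₃ + M)) by rw [hγ, hα]; field_simp; ring]
  refine hv.map_sub_le_of_le hM1 ?_
  calc v (α * (x₃ / (L * x₃ + M))) ≤ r ^ 2 * r := v.map_mul_le_of_le hLM ht₃
    _ = r ^ 3 := by ring

end FormalGroup

namespace WeierstrassCurve.Affine

variable {F : Type*} [Field F] {v : AbsoluteValue F ℝ} {W : WeierstrassCurve.Affine F}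

/-- The coefficients of `W` have absolute value at most `1`. -/
structure IntegralAt (W : WeierstrassCurve.Affine F) (v : AbsoluteValue F ℝ) : Prop where
  a₁ : v W.a₁ ≤ 1
  a₂ : v W.a₂ ≤ 1
  a₃ : v W.a₃ ≤ 1
  a₄ : v W.a₄ ≤ 1
  a₆ : v W.a₆ ≤ 1

lemma IntegralAt.b₂ (h : W.IntegralAt v) (hv : IsNonarchimedean v) : v W.b₂ ≤ 1 := by
  rw [WeierstrassCurve.b₂, sq]
  exact hv.map_add_le_of_le (v.map_mul_le_of_le_one h.a₁ h.a₁)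
    (v.map_mul_le_of_le_one (hv.map_ofNat_le_one 4) h.a₂)

lemma IntegralAt.b₄ (h : W.IntegralAt v) (hv : IsNonarchimedean v) : v W.b₄ ≤ 1 := by
  rw [WeierstrassCurve.b₄]
  exact hv.map_add_le_of_le (v.map_mul_le_of_le_one (hv.map_ofNat_le_one 2) h.a₄)
    (v.map_mul_le_of_le_one h.a₁ h.a₃)

lemma IntegralAt.b₆ (h : W.IntegralAt v) (hv : IsNonarchimedean v) : v W.b₆ ≤ 1 := by
  rw [WeierstrassCurve.b₆, sq]
  exact hv.map_add_le_of_le (v.map_mul_le_of_le_one h.a₃ h.a₃)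
    (v.map_mul_le_of_le_one (hv.map_ofNat_le_one 4) h.a₆)

lemma Equation.sq_eq {x y : F} (h : W.Equation x y) :
    (2 * y + W.a₁ * x + W.a₃) ^ 2 = 4 * x ^ 3 + W.b₂ * x ^ 2 + 2 * W.b₄ * x + W.b₆ := by
  rw [equation_iff] at h
  rw [WeierstrassCurve.b₂, WeierstrassCurve.b₄, WeierstrassCurve.b₆]
  linear_combination 4 * h

lemma IntegralAt.map_quadratic_le (hW : W.IntegralAt v) (hv : IsNonarchimedean v) {x : F} {a : ℝ}
    (ha : 1 ≤ a) (hx : v x ≤ a) : v (W.b₂ * x ^ 2 + 2 * W.b₄ * x + W.b₆) ≤ a ^ 2 := by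
  have haa : a ≤ a ^ 2 := by nlinarith
  refine hv.map_add_le_of_le (hv.map_add_le_of_le ?_ ?_) ?_
  · refine v.map_mul_le_of_le_one (hW.b₂ hv) ?_
    rw [map_pow]
    exact pow_le_pow_left₀ (v.nonneg _) hx 2
  · exact v.map_mul_le_of_le_one (v.map_mul_le_of_le_one (hv.map_ofNat_le_one 2) (hW.b₄ hv))
      (hx.trans haa)
  · exact (hW.b₆ hv).trans (ha.trans haa)

lemma IntegralAt.map_sq_eq (hW : W.IntegralAt v) (hv : IsNonarchimedean v) (hv2 : v 2 = 1)
    {x y : F} (h : W.Equation x y) (hx : 1 < v x) :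
    v (2 * y + W.a₁ * x + W.a₃) ^ 2 = v x ^ 3 := by
  have h4 : v (4 * x ^ 3) = v x ^ 3 := by
    rw [show (4 : F) = 2 * 2 by norm_num, v.map_mul, v.map_mul, hv2, map_pow, one_mul, one_mul]
  rw [← map_pow, h.sq_eq, add_assoc, add_assoc, hv.map_add_eq_left, h4]
  rw [h4, ← add_assoc]
  refine (hW.map_quadratic_le hv hx.le le_rfl).trans_lt ?_
  exact pow_lt_pow_right₀ hx (by norm_num)

lemma IntegralAt.map_y_le_one (hW : W.IntegralAt v) (hv : IsNonarchimedean v)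
    {x y : F} (h : W.Equation x y) (hx : v x ≤ 1) : v y ≤ 1 := by
  by_contra! hy
  rw [equation_iff] at h
  have h1 : v (y + (W.a₁ * x + W.a₃)) = v y := by
    refine hv.map_add_eq_left (lt_of_le_of_lt ?_ hy)
    exact hv.map_add_le_of_le (v.map_mul_le_of_le_one hW.a₁ hx) hW.a₃
  have h2 : v (y * (y + (W.a₁ * x + W.a₃))) ≤ 1 := by
    rw [show y * (y + (W.a₁ * x + W.a₃)) =
      x * (x * x) + W.a₂ * (x * x) + W.a₄ * x + W.a₆ by linear_combination h]
    have hxx := v.map_mul_le_of_le_one hx hx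
    exact hv.map_add_le_of_le (hv.map_add_le_of_le (hv.map_add_le_of_le
      (v.map_mul_le_of_le_one hx hxx) (v.map_mul_le_of_le_one hW.a₂ hxx))
      (v.map_mul_le_of_le_one hW.a₄ hx)) hW.a₆
  rw [v.map_mul, h1] at h2
  nlinarith

namespace Point

/-- The local parameter `x / (2 y + a₁ x + a₃)` at the origin. -/
noncomputable def localParameter : W.Point → F
  | .zero => 0
  | .some x y _ => x / (2 * y + W.a₁ * x + W.a₃)

/-- The points at distance at most `r` from the origin. -/
def IsNear (v : AbsoluteValue F ℝ) (r : ℝ) : W.Point → Prop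
  | .zero => True
  | .some x y _ => 2 * y + W.a₁ * x + W.a₃ ≠ 0 ∧ v (x / (2 * y + W.a₁ * x + W.a₃)) ≤ r ∧
      v (1 / (2 * y + W.a₁ * x + W.a₃)) ≤ r ^ 3

lemma isNear_of_one_lt (hW : W.IntegralAt v) (hv : IsNonarchimedean v) (hv2 : v 2 = 1)
    {x y : F} (h : W.Nonsingular x y) (hx : 1 < v x) :
    v (localParameter (.some x y h)) < 1 ∧
      IsNear v (v (localParameter (.some x y h))) (.some x y h) := by
  have hη := hW.map_sq_eq hv hv2 h.1 hx
  simp only [localParameter, IsNear]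
  set η := 2 * y + W.a₁ * x + W.a₃
  have hx0 : 0 < v x := one_pos.trans hx
  have hη0 : 0 < v η := by
    refine (v.nonneg _).lt_of_ne' fun h0 => ?_
    rw [h0] at hη
    rw [zero_pow two_ne_zero] at hη
    exact (pow_pos hx0 3).ne hη
  rw [map_div₀, map_div₀, v.map_one]
  have hlt : v x < v η := by
    by_contra! hle
    have : v η ^ 2 ≤ v x ^ 2 := pow_le_pow_left₀ hη0.le hle 2
    have : v x ^ 2 < v x ^ 3 := pow_lt_pow_right₀ hx (by norm_num)
    linarith
  refine ⟨(div_lt_one hη0).2 hlt, v.pos_iff.1 hη0, le_rfl, le_of_eq ?_⟩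
  rw [div_pow, ← hη]
  field_simp

lemma IsNear.one_lt (hW : W.IntegralAt v) (hv : IsNonarchimedean v) {r : ℝ} (hr : r < 1)
    {x y : F} {h : W.Nonsingular x y} (hP : IsNear v r (.some x y h)) : 1 < v x := by
  obtain ⟨hη, ht, hs⟩ := hP
  by_contra! hx
  have hr0 : 0 ≤ r := (v.nonneg _).trans ht
  have h1 : v ((2 * y + W.a₁ * x + W.a₃) ^ 2) ≤ 1 := by
    rw [h.1.sq_eq, add_assoc, add_assoc, ← add_assoc (W.b₂ * x ^ 2)]
    refine hv.map_add_le_of_le ?_ (by simpa using hW.map_quadratic_le hv le_rfl hx)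
    refine v.map_mul_le_of_le_one (hv.map_ofNat_le_one 4) ?_
    rw [map_pow]
    exact pow_le_one₀ (v.nonneg _) hx
  rw [map_pow] at h1
  have h2 : v (2 * y + W.a₁ * x + W.a₃) ≤ 1 := (sq_le_one_iff₀ (v.nonneg _)).1 h1
  have h3 : v (1 / (2 * y + W.a₁ * x + W.a₃)) < 1 :=
    hs.trans_lt (pow_lt_one₀ hr0 hr (by norm_num))
  rw [map_div₀, v.map_one, div_lt_one (v.pos hη)] at h3
  exact absurd h3 (not_lt.2 h2)

variable [DecidableEq F]

lemma IsNear.add (hW : W.IntegralAt v) (hv : IsNonarchimedean v) (hv2 : v 2 = 1) {r : ℝ}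
    (hr0 : 0 ≤ r) (hr : r < 1) {P Q : W.Point} (hP : IsNear v r P) (hQ : IsNear v r Q) :
    IsNear v r (P + Q) ∧
      v ((P + Q).localParameter - (P.localParameter + Q.localParameter)) ≤ r ^ 3 := by
  rcases P with _ | ⟨x₁, y₁, h₁⟩
  · rw [← zero_def, zero_add]
    refine ⟨hQ, ?_⟩
    simp only [localParameter, zero_add, sub_self, v.map_zero]
    positivity
  rcases Q with _ | ⟨x₂, y₂, h₂⟩
  · rw [← zero_def, add_zero]
    refine ⟨hP, ?_⟩
    simp only [localParameter, add_zero, sub_self, v.map_zero]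
    positivity
  by_cases hxy : x₁ = x₂ ∧ y₁ = W.negY x₂ y₂
  · rw [add_of_Y_eq hxy.1 hxy.2]
    refine ⟨trivial, ?_⟩
    obtain ⟨rfl, rfl⟩ := hxy
    simp only [localParameter, negY]
    rw [show 2 * (-y₂ - W.a₁ * x₁ - W.a₃) + W.a₁ * x₁ + W.a₃ =
      -(2 * y₂ + W.a₁ * x₁ + W.a₃) by ring, div_neg, neg_add_cancel, sub_zero, v.map_zero]
    positivity
  rw [add_some hxy]
  simp only [IsNear, localParameter]
  have hpoly := addPolynomial_slope h₁.1 h₂.1 hxy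
  have hl₂ : y₂ = W.slope x₁ x₂ y₁ y₂ * (x₂ - x₁) + y₁ := by
    by_cases hx : x₁ = x₂
    · rw [← hx, Y_eq_of_Y_ne h₁.1 h₂.1 hx fun h => hxy ⟨hx, h⟩]
      simp
    · rw [slope_of_X_ne hx]
      have := sub_ne_zero.2 hx
      field_simp
      ring
  set ℓ := W.slope x₁ x₂ y₁ y₂
  set x₃ := W.addX x₁ x₂ ℓ with hx₃
  have e₁ : x₃ = ℓ ^ 2 + W.a₁ * ℓ - W.a₂ - x₁ - x₂ := rfl
  rw [addPolynomial_eq, neg_inj] at hpoly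
  have p0 := congrArg (Polynomial.eval 0) hpoly
  have p1 := congrArg (Polynomial.eval 1) hpoly
  simp only [Cubic.toPoly, Polynomial.eval_add, Polynomial.eval_mul, Polynomial.eval_sub,
    Polynomial.eval_pow, Polynomial.eval_X, Polynomial.eval_C] at p0 p1
  clear_value x₃ ℓ
  obtain ⟨hη₁, ht₁, hs₁⟩ := hP
  obtain ⟨hη₂, ht₂, hs₂⟩ := hQ
  have key := third_point_bound (x₃ := x₃) (L := 2 * ℓ + W.a₁)
    (M := 2 * (y₁ - ℓ * x₁) + W.a₃) hv hv2 (hW.b₂ hv) (hW.b₄ hv) (hW.b₆ hv) hr hη₁ hη₂ ht₁ ht₂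
    hs₁ hs₂ h₁.1.sq_eq h₂.1.sq_eq (by ring) (by rw [hl₂]; ring)
    (by rw [e₁, WeierstrassCurve.b₂]; ring)
    (by rw [WeierstrassCurve.b₄]; linear_combination 4 * p0 - 4 * p1 + 4 * e₁)
    (by rw [WeierstrassCurve.b₆]; linear_combination 4 * p0)
  have hη₃ : 2 * W.addY x₁ x₂ y₁ ℓ + W.a₁ * x₃ + W.a₃ =
      -((2 * ℓ + W.a₁) * x₃ + (2 * (y₁ - ℓ * x₁) + W.a₃)) := by
    rw [hx₃, addY, negAddY, negY]; ring
  rw [hη₃, div_neg, div_neg, v.map_neg, v.map_neg, neg_ne_zero]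
  refine ⟨⟨key.1, key.2.1, key.2.2.1⟩, ?_⟩
  rw [neg_sub_left, v.map_neg, add_comm]
  convert key.2.2.2 using 2
  ring

lemma IsNear.nsmul (hW : W.IntegralAt v) (hv : IsNonarchimedean v) (hv2 : v 2 = 1) {r : ℝ}
    (hr0 : 0 ≤ r) (hr : r < 1) {P : W.Point} (hP : IsNear v r P) (n : ℕ) :
    IsNear v r (n • P) ∧ v ((n • P).localParameter - n * P.localParameter) ≤ r ^ 3 := by
  induction n with
  | zero =>
    rw [zero_smul]
    refine ⟨trivial, ?_⟩
    simp only [localParameter, Nat.cast_zero, zero_mul, sub_zero, v.map_zero]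
    positivity
  | succ n ih =>
    have := IsNear.add hW hv hv2 hr0 hr ih.1 hP
    rw [succ_nsmul]
    refine ⟨this.1, ?_⟩
    convert hv.map_add_le_of_le this.2 ih.2 using 2
    push_cast
    ring

lemma IsNear.eq_zero_of_prime_nsmul (hW : W.IntegralAt v) (hv : IsNonarchimedean v)
    (hv2 : v 2 = 1) {c : ℝ} (hc : ∀ x, v x < 1 → v x ≤ c) {q : ℕ} (hq : c ^ 2 < v (q : F))
    {r : ℝ} (hr : r < 1) {P : W.Point} (hP : IsNear v r P) (h : q • P = 0) : P = 0 := by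
  rcases P with _ | ⟨x, y, hxy⟩
  · rfl
  exfalso
  have hx := IsNear.one_lt hW hv hr hP
  obtain ⟨hlt, hnear⟩ := isNear_of_one_lt hW hv hv2 hxy hx
  have hpos : 0 < v (localParameter (.some x y hxy)) := by
    refine v.pos (div_ne_zero ?_ hP.1)
    rintro rfl
    rw [v.map_zero] at hx
    exact absurd hx (by norm_num)
  have key := (IsNear.nsmul hW hv hv2 hpos.le hlt hnear q).2
  rw [h] at key
  set t := v (localParameter (.some x y hxy)) with ht
  have h0 : (0 : W.Point).localParameter = 0 := rfl
  rw [h0, zero_sub, v.map_neg, v.map_mul, ← ht] at key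
  have htc := hc _ hlt
  have : t ^ 2 ≤ c ^ 2 := pow_le_pow_left₀ hpos.le htc 2
  nlinarith

lemma IsNear.eq_zero_of_isOfFinAddOrder (hW : W.IntegralAt v) (hv : IsNonarchimedean v)
    (hv2 : v 2 = 1) {c : ℝ} (hc : ∀ x, v x < 1 → v x ≤ c)
    (hq : ∀ q : ℕ, q.Prime → c ^ 2 < v (q : F)) {r : ℝ} (hr0 : 0 ≤ r) (hr : r < 1) {P : W.Point}
    (hP : IsNear v r P) (h : IsOfFinAddOrder P) : P = 0 := by
  obtain ⟨n, hn, h⟩ := isOfFinAddOrder_iff_nsmul_eq_zero.1 h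
  induction n using induction_on_primes with
  | zero => exact absurd hn (lt_irrefl _)
  | one => rwa [one_smul] at h
  | prime_mul q a hqp ih =>
    refine ih (Nat.pos_of_mul_pos_left hn) ?_
    rw [mul_smul] at h
    exact IsNear.eq_zero_of_prime_nsmul hW hv hv2 hc (hq q hqp) hr
      (IsNear.nsmul hW hv hv2 hr0 hr hP a).1 h

lemma map_x_le_one_of_isOfFinAddOrder (hW : W.IntegralAt v) (hv : IsNonarchimedean v)
    (hv2 : v 2 = 1) {c : ℝ} (hc : ∀ x, v x < 1 → v x ≤ c)
    (hq : ∀ q : ℕ, q.Prime → c ^ 2 < v (q : F)) {x y : F} (hxy : W.Nonsingular x y)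
    (h : IsOfFinAddOrder (.some x y hxy : W.Point)) : v x ≤ 1 := by
  by_contra! hx
  obtain ⟨hlt, hnear⟩ := isNear_of_one_lt hW hv hv2 hxy hx
  exact some_ne_zero hxy
    (IsNear.eq_zero_of_isOfFinAddOrder hW hv hv2 hc hq (v.nonneg _) hlt hnear h)

/-- Torsion points that agree modulo the maximal ideal are equal, as long as they do not reduce to
a `2`-torsion point. -/
lemma eq_of_reduction_eq (hW : W.IntegralAt v) (hv : IsNonarchimedean v)
    (hv2 : v 2 = 1) {c : ℝ} (hc : ∀ x, v x < 1 → v x ≤ c)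
    (hq : ∀ q : ℕ, q.Prime → c ^ 2 < v (q : F)) {x₁ y₁ x₂ y₂ : F} (h₁ : W.Nonsingular x₁ y₁)
    (h₂ : W.Nonsingular x₂ y₂) (ho₁ : IsOfFinAddOrder (.some x₁ y₁ h₁ : W.Point))
    (ho₂ : IsOfFinAddOrder (.some x₂ y₂ h₂ : W.Point)) (hx₁ : v x₁ ≤ 1) (hx₂ : v x₂ ≤ 1)
    (hx : v (x₁ - x₂) < 1) (hy : v (y₁ - y₂) < 1) (hη : 1 ≤ v (2 * y₂ + W.a₁ * x₂ + W.a₃)) :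
    (.some x₁ y₁ h₁ : W.Point) = .some x₂ y₂ h₂ := by
  have hη' : 1 ≤ v (y₁ - W.negY x₂ y₂) := by
    rw [negY, show y₁ - (-y₂ - W.a₁ * x₂ - W.a₃) =
      (2 * y₂ + W.a₁ * x₂ + W.a₃) + (y₁ - y₂) by ring, hv.map_add_eq_left (hy.trans_le hη)]
    exact hη
  by_cases hxe : x₁ = x₂
  · rcases Y_eq_of_X_eq h₁.1 h₂.1 hxe with h | h
    · subst hxe h; rfl
    · rw [h, sub_self, v.map_zero] at hη'
      exact absurd hη' (by norm_num)
  exfalso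
  have hsum : IsOfFinAddOrder ((.some x₁ y₁ h₁ : W.Point) + -.some x₂ y₂ h₂) :=
    ho₁.add ho₂.neg
  rw [neg_some, add_of_X_ne hxe] at hsum
  have hle := map_x_le_one_of_isOfFinAddOrder hW hv hv2 hc hq _ hsum
  have hd : 0 < v (x₁ - x₂) := v.pos (sub_ne_zero.2 hxe)
  have hℓ : 1 < v (W.slope x₁ x₂ y₁ (W.negY x₂ y₂)) := by
    rw [slope_of_X_ne hxe, map_div₀, one_lt_div hd]
    exact hx.trans_le hη'
  set ℓ := W.slope x₁ x₂ y₁ (W.negY x₂ y₂)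
  have h1 : v (ℓ + W.a₁) = v ℓ := hv.map_add_eq_left (hW.a₁.trans_lt hℓ)
  have h2 : v (ℓ * (ℓ + W.a₁)) ≤ 1 := by
    rw [show ℓ * (ℓ + W.a₁) = W.addX x₁ x₂ ℓ + W.a₂ + x₁ + x₂ by rw [addX]; ring]
    exact hv.map_add_le_of_le (hv.map_add_le_of_le (hv.map_add_le_of_le hle hW.a₂) hx₁) hx₂
  rw [v.map_mul, h1] at h2
  nlinarith

/-- The torsion points of a curve with integral coefficients inject into the points of its
reduction, provided that the reduction has no point of order two. -/
theorem exists_torsion_reduction_injective {k : Type*} [Field k] {O : Subring F}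
    (hO : ∀ x, x ∈ O ↔ v x ≤ 1) (ρ : O →+* k) (hρ : ∀ x : O, ρ x = 0 ↔ v (x : F) < 1)
    (hv : IsNonarchimedean v) (hv2 : v 2 = 1) {c : ℝ} (hc : ∀ x, v x < 1 → v x ≤ c)
    (hq : ∀ q : ℕ, q.Prime → c ^ 2 < v (q : F)) (W₀ : WeierstrassCurve O)
    (hW₀ : W = W₀.map O.subtype)
    (htwo : ∀ x y : k, (W₀.map ρ).toAffine.Equation x y → 2 * y + ρ W₀.a₁ * x + ρ W₀.a₃ ≠ 0) :
    ∃ f : AddCommGroup.torsion W.Point →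
      Option {z : k × k // (W₀.map ρ).toAffine.Equation z.1 z.2}, Function.Injective f := by
  have hW : W.IntegralAt v := by
    subst hW₀
    exact ⟨(hO _).1 W₀.a₁.2, (hO _).1 W₀.a₂.2, (hO _).1 W₀.a₃.2, (hO _).1 W₀.a₄.2,
      (hO _).1 W₀.a₆.2⟩
  have hred {x y : O} (h : W.Equation x y) : (W₀.map ρ).toAffine.Equation (ρ x) (ρ y) := by
    subst hW₀
    exact Equation.map ρ ((map_equation _ O.subtype_injective x y).1 h)
  have hex : ∀ P : AddCommGroup.torsion W.Point,
      ∃ o : Option {z : k × k // (W₀.map ρ).toAffine.Equation z.1 z.2},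
        (o = none ∧ P.1 = 0) ∨ ∃ (x y : O) (h : W.Nonsingular x y),
          P.1 = .some x y h ∧ o.map Subtype.val = Option.some (ρ x, ρ y) := by
    rintro ⟨P, hP⟩
    rcases P with _ | ⟨x, y, h⟩
    · exact ⟨none, Or.inl ⟨rfl, rfl⟩⟩
    have hx := map_x_le_one_of_isOfFinAddOrder hW hv hv2 hc hq h hP
    have hy := hW.map_y_le_one hv h.1 hx
    exact ⟨Option.some ⟨(ρ ⟨x, (hO x).2 hx⟩, ρ ⟨y, (hO y).2 hy⟩), hred h.1⟩, Or.inr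
      ⟨⟨x, (hO x).2 hx⟩, ⟨y, (hO y).2 hy⟩, h, rfl, rfl⟩⟩
  choose f hf using hex
  refine ⟨f, fun P Q hPQ => Subtype.ext ?_⟩
  rcases hf P with ⟨hP, hP'⟩ | ⟨x₁, y₁, h₁, hP', hP⟩ <;>
    rcases hf Q with ⟨hQ, hQ'⟩ | ⟨x₂, y₂, h₂, hQ', hQ⟩
  · rw [hP', hQ']
  · rw [← hPQ, hP] at hQ; cases hQ
  · rw [hPQ, hQ] at hP; cases hP
  rw [hPQ, hQ, Option.some_inj, Prod.mk.injEq] at hP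
  rw [hP', hQ']
  refine eq_of_reduction_eq hW hv hv2 hc hq h₁ h₂ (hP' ▸ P.2) (hQ' ▸ Q.2) ((hO _).1 x₁.2)
    ((hO _).1 x₂.2) ?_ ?_ ?_
  · have := (hρ (x₁ - x₂)).1 (by rw [map_sub, hP.1, sub_self])
    exact this
  · have := (hρ (y₁ - y₂)).1 (by rw [map_sub, hP.2, sub_self])
    exact this
  · have h := htwo _ _ (hred h₂.1)
    have := (hρ (2 * y₂ + W₀.a₁ * x₂ + W₀.a₃)).not.1 (by
      simpa [show ρ 2 = 2 from map_ofNat ρ 2] using h)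
    rw [not_lt] at this
    subst hW₀
    exact this

end Point

end WeierstrassCurve.Affine

section Padic

open Polynomial

variable {p : ℕ} [Fact p.Prime]

lemma PadicInt.toZMod_eq_zero_iff {x : ℤ_[p]} : toZMod x = 0 ↔ ‖x‖ < 1 := by
  rw [← RingHom.mem_ker, ker_toZMod, IsLocalRing.mem_maximalIdeal, mem_nonunits]

/-- An integer polynomial with as many simple roots modulo `p` as its degree splits over `ℚ_[p]`. -/
lemma Polynomial.splits_padic_of_simple_roots {f : ℤ[X]} (hf : f ≠ 0) {s : Finset (ZMod p)}
    (hs : ∀ b ∈ s, aeval b f = 0 ∧ aeval b (derivative f) ≠ 0) (hcard : f.natDegree ≤ s.card) :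
    (f.map (Int.castRingHom ℚ_[p])).Splits := by
  have hlift : ∀ b : s, ∃ z : ℤ_[p], aeval z f = 0 ∧ PadicInt.toZMod z = b := by
    rintro ⟨b, hb⟩
    obtain ⟨a, rfl⟩ := ZMod.ringHom_surjective PadicInt.toZMod b
    have key (g : ℤ[X]) : aeval (PadicInt.toZMod a) g = PadicInt.toZMod (aeval a g) :=
      aeval_algHom_apply (PadicInt.toZMod (p := p)).toIntAlgHom a g
    obtain ⟨h0, h1⟩ := hs _ hb
    rw [key, PadicInt.toZMod_eq_zero_iff] at h0
    rw [key, Ne, PadicInt.toZMod_eq_zero_iff] at h1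
    have h1' : ‖aeval a (derivative f)‖ = 1 := le_antisymm (PadicInt.norm_le_one _) (not_lt.1 h1)
    obtain ⟨z, hz, hza, -⟩ := hensels_lemma (F := f) (a := a) (by rwa [h1', one_pow])
    rw [h1', ← PadicInt.toZMod_eq_zero_iff, map_sub, sub_eq_zero] at hza
    exact ⟨z, hz, hza⟩
  choose z hz hzb using hlift
  have hinj : Function.Injective fun b => (z b : ℚ_[p]) := fun a b hab =>
    Subtype.ext (by rw [← hzb a, ← hzb b, Subtype.ext hab])
  have hf' : f.map (Int.castRingHom ℚ_[p]) ≠ 0 :=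
    (Polynomial.map_ne_zero_iff (RingHom.injective_int _)).2 hf
  have hdeg : (f.map (Int.castRingHom ℚ_[p])).natDegree = f.natDegree :=
    natDegree_map_eq_of_injective (RingHom.injective_int _) f
  rw [splits_iff_card_roots, hdeg]
  refine le_antisymm (hdeg ▸ card_roots' _) ?_
  classical
  calc f.natDegree ≤ s.card := hcard
    _ = (Finset.univ.image fun b => (z b : ℚ_[p])).card := by
      rw [Finset.card_image_of_injective _ hinj, Finset.card_univ, Fintype.card_coe]
    _ ≤ (f.map (Int.castRingHom ℚ_[p])).roots.toFinset.card := by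
      refine Finset.card_le_card fun x hx => ?_
      obtain ⟨b, -, rfl⟩ := Finset.mem_image.1 hx
      rw [Multiset.mem_toFinset, mem_roots hf', IsRoot, eval_map]
      have := congrArg (PadicInt.Coe.ringHom (p := p)) (hz b)
      rwa [map_zero, aeval_def, hom_eval₂, RingHom.eq_intCast' (RingHom.comp _ _)] at this
    _ ≤ _ := Multiset.toFinset_card_le _

variable {K : Type*} [Field K] (φ : K →+* ℚ_[p])

/-- The absolute value induced by an embedding into the `p`-adic numbers. -/
noncomputable def padicAbsoluteValue : AbsoluteValue K ℝ where
  toFun x := ‖φ x‖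
  map_mul' x y := by rw [map_mul, norm_mul]
  nonneg' _ := norm_nonneg _
  eq_zero' x := by rw [norm_eq_zero, map_eq_zero]
  add_le' x y := by rw [map_add]; exact norm_add_le _ _

/-- The elements that are integral with respect to an embedding into the `p`-adic numbers. -/
noncomputable def padicIntegers : Subring K := (PadicInt.subring p).comap φ

/-- Reduction modulo `p` of the elements of `padicIntegers`. -/
noncomputable def padicResidue : padicIntegers φ →+* ZMod p :=
  PadicInt.toZMod.comp (φ.restrict (padicIntegers φ) (PadicInt.subring p) fun _ h => h)

lemma isNonarchimedean_padicAbsoluteValue : IsNonarchimedean (padicAbsoluteValue φ) := by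
  intro x y
  change ‖φ (x + y)‖ ≤ max ‖φ x‖ ‖φ y‖
  rw [map_add]
  exact Padic.nonarchimedean _ _

lemma mem_padicIntegers_iff (x : K) : x ∈ padicIntegers φ ↔ padicAbsoluteValue φ x ≤ 1 :=
  Iff.rfl

lemma padicResidue_eq_zero_iff (x : padicIntegers φ) :
    padicResidue φ x = 0 ↔ padicAbsoluteValue φ x < 1 :=
  PadicInt.toZMod_eq_zero_iff

lemma padicAbsoluteValue_natCast (n : ℕ) : padicAbsoluteValue φ n = ‖(n : ℚ_[p])‖ :=
  congrArg norm (map_natCast φ n)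

lemma padicAbsoluteValue_le_inv {x : K} (hx : padicAbsoluteValue φ x < 1) :
    padicAbsoluteValue φ x ≤ (p : ℝ)⁻¹ := by
  let z : ℤ_[p] := ⟨φ x, hx.le⟩
  obtain ⟨y, hy⟩ := (PadicInt.norm_lt_one_iff_dvd z).1 hx
  change ‖z‖ ≤ _
  rw [hy, norm_mul, PadicInt.norm_p]
  exact mul_le_of_le_one_right (by positivity) (PadicInt.norm_le_one _)

lemma inv_sq_lt_padicAbsoluteValue {q : ℕ} (hq : q.Prime) :
    (p : ℝ)⁻¹ ^ 2 < padicAbsoluteValue φ q := by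
  have hp := (Fact.out : p.Prime)
  have hp1 : (1 : ℝ) < p := by exact_mod_cast hp.one_lt
  have hinv : (p : ℝ)⁻¹ < 1 := inv_lt_one_of_one_lt₀ hp1
  have hinv0 : 0 < (p : ℝ)⁻¹ := by positivity
  rw [padicAbsoluteValue_natCast]
  by_cases h : p = q
  · rw [← h, Padic.norm_p]
    nlinarith
  · rw [Padic.norm_natCast_eq_one_iff.2 ((Nat.coprime_primes hp hq).2 h)]
    nlinarith

lemma padicAbsoluteValue_two (hp : p ≠ 2) : padicAbsoluteValue φ 2 = 1 := by
  have := padicAbsoluteValue_natCast φ 2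
  rw [Nat.cast_ofNat] at this
  rw [this, Padic.norm_natCast_eq_one_iff]
  exact (Nat.coprime_primes Fact.out Nat.prime_two).2 hp

end Padic

/-- The Tate normal form `y² + (1 - c) x y - b y = x³ - b x²`. -/
def tateNormalForm {R : Type*} [CommRing R] (b c : R) : WeierstrassCurve R :=
  { a₁ := 1 - c, a₂ := -b, a₃ := -b, a₄ := 0, a₆ := 0 }

section TateNormalForm

open WeierstrassCurve.Affine

lemma tateNormalForm_map {R S : Type*} [CommRing R] [CommRing S] (f : R →+* S) (b c : R) :
    (tateNormalForm b c).map f = tateNormalForm (f b) (f c) := by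
  simp [tateNormalForm, WeierstrassCurve.map]

lemma tateNormalForm_equation_iff {R : Type*} [CommRing R] (b c x y : R) :
    (tateNormalForm b c).toAffine.Equation x y ↔
      y ^ 2 + (1 - c) * x * y + -b * y = x ^ 3 + -b * x ^ 2 := by
  rw [equation_iff]
  simp [tateNormalForm]

lemma tateNormalForm_integralAt {K : Type*} [Field K] {p : ℕ} [Fact p.Prime] (φ : K →+* ℚ_[p])
    (b c : padicIntegers φ) :
    (tateNormalForm (b : K) (c : K)).toAffine.IntegralAt (padicAbsoluteValue φ) where
  a₁ := (1 - c).2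
  a₂ := (-b).2
  a₃ := (-b).2
  a₄ := (0 : padicIntegers φ).2
  a₆ := (0 : padicIntegers φ).2

variable {K : Type*} [Field K] [DecidableEq K]

lemma tateNormalForm_add_self {b c x y ℓ : K}
    {h : (tateNormalForm b c).toAffine.Nonsingular x y}
    (hη : 2 * y + (1 - c) * x - b ≠ 0)
    (hℓ : ℓ * (2 * y + (1 - c) * x - b) = 3 * x ^ 2 - 2 * b * x - (1 - c) * y) {x' y' : K}
    (hx' : x' = ℓ ^ 2 + (1 - c) * ℓ + b - 2 * x)
    (hy' : y' = -(ℓ * (x' - x) + y) - (1 - c) * x' + b) :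
    ∃ h' : (tateNormalForm b c).toAffine.Nonsingular x' y',
      (Point.some x y h + Point.some x y h : (tateNormalForm b c).toAffine.Point) =
        Point.some x' y' h' := by
  have hη' : y - (tateNormalForm b c).toAffine.negY x y = 2 * y + (1 - c) * x - b := by
    simp only [negY, tateNormalForm]
    ring
  have hy : y ≠ (tateNormalForm b c).toAffine.negY x y := by
    rw [← sub_ne_zero, hη']
    exact hη
  have hs : (tateNormalForm b c).toAffine.slope x x y y = ℓ := by
    rw [slope_of_Y_ne rfl hy, hη', div_eq_iff hη, hℓ]
    simp only [tateNormalForm]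
    ring
  have hX : (tateNormalForm b c).toAffine.addX x x ℓ = x' := by
    rw [hx', addX]
    simp only [tateNormalForm]
    ring
  have hY : (tateNormalForm b c).toAffine.addY x x y ℓ = y' := by
    rw [hy', addY, negAddY, hX, negY]
    simp only [tateNormalForm]
    ring
  have hadd := Point.add_self_of_Y_ne (h₁ := h) hy
  subst hX hY hs
  exact ⟨_, hadd⟩

lemma tateNormalForm_eq_of_two_nsmul {b c x y : K}
    {h : (tateNormalForm b c).toAffine.Nonsingular x y}
    (h2 : 2 • (Point.some x y h : (tateNormalForm b c).toAffine.Point) = 0) :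
    2 * y + (1 - c) * x - b = 0 := by
  by_contra hη
  obtain ⟨h', hadd⟩ := tateNormalForm_add_self (h := h) hη (div_mul_cancel₀ _ hη) rfl rfl
  rw [two_nsmul, hadd] at h2
  exact Point.some_ne_zero _ h2

/-- Three-torsion points are roots of the third division polynomial. -/
lemma tateNormalForm_eq_of_three_nsmul {b c x y : K}
    {h : (tateNormalForm b c).toAffine.Nonsingular x y}
    (h3 : 3 • (Point.some x y h : (tateNormalForm b c).toAffine.Point) = 0) :
    3 * x ^ 4 + ((1 - c) ^ 2 - 4 * b) * x ^ 3 - 3 * (1 - c) * b * x ^ 2 + 3 * b ^ 2 * x - b ^ 3 =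
      0 := by
  have hPP : (Point.some x y h + Point.some x y h : (tateNormalForm b c).toAffine.Point) =
      -Point.some x y h := by
    rw [eq_neg_iff_add_eq_zero, ← h3]
    abel
  have hη : 2 * y + (1 - c) * x - b ≠ 0 := by
    intro hη
    have hy : y = (tateNormalForm b c).toAffine.negY x y := by
      simp only [negY, tateNormalForm]
      linear_combination hη
    rw [Point.add_of_Y_eq rfl hy, eq_comm, neg_eq_zero] at hPP
    exact Point.some_ne_zero h hPP
  have hℓ := div_mul_cancel₀ (3 * x ^ 2 - 2 * b * x - (1 - c) * y) hη
  obtain ⟨h', hadd⟩ := tateNormalForm_add_self (h := h) hη hℓ rfl rfl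
  rw [hadd, Point.neg_some, Point.some.injEq] at hPP
  have hx := hPP.1
  have he := (tateNormalForm_equation_iff _ _ _ _).1 h.1
  set η := 2 * y + (1 - c) * x - b with hηdef
  set s := 3 * x ^ 2 - 2 * b * x - (1 - c) * y with hs
  set ℓ := s / η
  have hE : s ^ 2 + (1 - c) * s * η + (b - 3 * x) * η ^ 2 = 0 := by
    linear_combination η ^ 2 * hx - (ℓ * η + s + (1 - c) * η) * hℓ
  rw [hηdef, hs] at hE
  linear_combination -hE + (4 * (b - 3 * x) - (1 - c) ^ 2) * he

variable {p : ℕ} [Fact p.Prime] {φ : K →+* ℚ_[p]} {b c : padicIntegers φ}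

lemma tateNormalForm_exists_integral (hp : p ≠ 2) {x y : K}
    {h : (tateNormalForm (b : K) (c : K)).toAffine.Nonsingular x y}
    (ho : IsOfFinAddOrder (Point.some x y h : (tateNormalForm (b : K) (c : K)).toAffine.Point)) :
    ∃ x' y' : padicIntegers φ, (x' : K) = x ∧ (y' : K) = y ∧
      (tateNormalForm (padicResidue φ b) (padicResidue φ c)).toAffine.Equation
        (padicResidue φ x') (padicResidue φ y') := by
  have hW := tateNormalForm_integralAt φ b c
  have hv := isNonarchimedean_padicAbsoluteValue φ
  have hx := Point.map_x_le_one_of_isOfFinAddOrder hW hv (padicAbsoluteValue_two φ hp)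
    (fun _ => padicAbsoluteValue_le_inv φ) (fun _ => inv_sq_lt_padicAbsoluteValue φ) h ho
  let x' : padicIntegers φ := ⟨x, hx⟩
  let y' : padicIntegers φ := ⟨y, hW.map_y_le_one hv h.1 hx⟩
  refine ⟨x', y', rfl, rfl, ?_⟩
  have h' : ((tateNormalForm b c).map (padicIntegers φ).subtype).toAffine.Equation x' y' := by
    rw [tateNormalForm_map]
    exact h.1
  rw [← tateNormalForm_map]
  exact Equation.map _ ((map_equation _ (padicIntegers φ).subtype_injective x' y').1 h')

lemma tateNormalForm_two_nsmul_ne_zero (hp : p ≠ 2)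
    (htwo : ∀ x y, (tateNormalForm (padicResidue φ b) (padicResidue φ c)).toAffine.Equation x y →
      2 * y + (1 - padicResidue φ c) * x - padicResidue φ b ≠ 0)
    {P : (tateNormalForm (b : K) (c : K)).toAffine.Point} (hP : P ≠ 0) : 2 • P ≠ 0 := by
  intro h2
  rcases P with _ | ⟨x, y, h⟩
  · exact hP rfl
  obtain ⟨x', y', rfl, rfl, he⟩ := tateNormalForm_exists_integral hp
    (isOfFinAddOrder_iff_nsmul_eq_zero.2 ⟨2, two_pos, h2⟩)
  have hy' : 2 * y' + (1 - c) * x' - b = 0 := Subtype.ext (tateNormalForm_eq_of_two_nsmul h2)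
  refine htwo _ _ he ?_
  have := congrArg (padicResidue φ) hy'
  simpa [show padicResidue φ 2 = 2 from map_ofNat _ 2] using this

lemma tateNormalForm_three_nsmul_ne_zero (hp : p ≠ 2)
    (hthree : ∀ x, 3 * x ^ 4 + ((1 - padicResidue φ c) ^ 2 - 4 * padicResidue φ b) * x ^ 3 -
      3 * (1 - padicResidue φ c) * padicResidue φ b * x ^ 2 + 3 * padicResidue φ b ^ 2 * x -
      padicResidue φ b ^ 3 ≠ 0)
    {P : (tateNormalForm (b : K) (c : K)).toAffine.Point} (hP : P ≠ 0) : 3 • P ≠ 0 := by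
  intro h3
  rcases P with _ | ⟨x, y, h⟩
  · exact hP rfl
  obtain ⟨x', y', rfl, rfl, -⟩ := tateNormalForm_exists_integral hp
    (isOfFinAddOrder_iff_nsmul_eq_zero.2 ⟨3, three_pos, h3⟩)
  have hψ : 3 * x' ^ 4 + ((1 - c) ^ 2 - 4 * b) * x' ^ 3 - 3 * (1 - c) * b * x' ^ 2 +
      3 * b ^ 2 * x' - b ^ 3 = 0 := by
    exact Subtype.ext (tateNormalForm_eq_of_three_nsmul h3)
  refine hthree (padicResidue φ x') ?_
  have := congrArg (padicResidue φ) hψ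
  simpa [show padicResidue φ 3 = 3 from map_ofNat _ 3,
    show padicResidue φ 4 = 4 from map_ofNat _ 4] using this

lemma tateNormalForm_torsion_card_le (hp : p ≠ 2)
    (htwo : ∀ x y, (tateNormalForm (padicResidue φ b) (padicResidue φ c)).toAffine.Equation x y →
      2 * y + (1 - padicResidue φ c) * x - padicResidue φ b ≠ 0) :
    Finite (AddCommGroup.torsion (tateNormalForm (b : K) (c : K)).toAffine.Point) ∧
    Nat.card (AddCommGroup.torsion (tateNormalForm (b : K) (c : K)).toAffine.Point) ≤
      Nat.card {z : ZMod p × ZMod p //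
        (tateNormalForm (padicResidue φ b) (padicResidue φ c)).toAffine.Equation z.1 z.2} + 1 := by
  have key := Point.exists_torsion_reduction_injective
    (W := (tateNormalForm (b : K) (c : K)).toAffine) (mem_padicIntegers_iff φ) (padicResidue φ)
    (padicResidue_eq_zero_iff φ) (isNonarchimedean_padicAbsoluteValue φ)
    (padicAbsoluteValue_two φ hp) (fun _ => padicAbsoluteValue_le_inv φ)
    (fun _ => inv_sq_lt_padicAbsoluteValue φ) (tateNormalForm b c)
    (tateNormalForm_map (padicIntegers φ).subtype b c).symm
  rw [tateNormalForm_map] at key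
  obtain ⟨f, hf⟩ := key fun x y h => by
    simpa [tateNormalForm, sub_eq_add_neg] using htwo x y h
  refine ⟨Finite.of_injective f hf, ?_⟩
  have hcard := Nat.card_le_card_of_injective f hf
  rwa [Finite.card_option] at hcard

end TateNormalForm

section Origin

open WeierstrassCurve.Affine

variable {K : Type*} [Field K] [DecidableEq K] [CharZero K]

/-- The origin has order `17` on the Tate normal form in question. -/
lemma tateNormalForm_addOrderOf_origin {β b c : K}
    (hβ : 8 * β ^ 4 + 14 * β ^ 3 - 11 * β ^ 2 - 11 * β - 2 = 0)
    (hb : b = -(6901 / 1024) * β ^ 3 - (41387 / 4096) * β ^ 2 + (91011 / 8192) * β + 39449 / 8192)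
    (hc : c = -(139 / 16) * β ^ 3 - (725 / 64) * β ^ 2 + (2301 / 128) * β + 871 / 128) :
    ∃ P : (tateNormalForm b c).toAffine.Point, addOrderOf P = 17 := by
  have hη0 : (53 / 2 * β ^ 3 + 239 / 8 * β ^ 2 - 701 / 16 * β - 133 / 8) * (2 * 0 + (1 - c) * 0 -
    b) = 1 := by
    rw [hb]
    linear_combination (365753 / 16384 * β ^ 2 + 1282579 / 65536 * β - 5181181 / 131072) * hβ
  have hη1 : (-265 / 32 * β ^ 3 + 261 / 128 * β ^ 2 + 969 / 256 * β + 401 / 128) * (2 * (-172433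
    / 131072 * β ^ 3 - 1971855 / 524288 * β ^ 2 - 2112121 / 1048576 * β + 120037 / 1048576) + (1
    - c) * b - b) = 1 := by
    rw [hb, hc]
    linear_combination (254198335 / 4194304 * β ^ 5 + 410297523 / 8388608 * β ^ 4 - 11987407357 /
      67108864 * β ^ 3 - 585549389 / 33554432 * β ^ 2 + 10422329663 / 268435456 * β + 13816339733
      / 268435456) * hβ
  have hη2 : (-609 / 16 * β ^ 3 - 3689 / 64 * β ^ 2 + 4753 / 64 * β + 927 / 32) * (2 * (-187961 /
    65536 * β ^ 3 - 941799 / 262144 * β ^ 2 + 3437727 / 524288 * β + 1437357 / 524288) + (1 - c)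
    * (-1495 / 512 * β ^ 3 - 7945 / 2048 * β ^ 2 + 24785 / 4096 * β + 9891 / 4096) - b) = 1 := by
    rw [hb, hc]
    linear_combination (126553245 / 1048576 * β ^ 5 + 18958625 / 65536 * β ^ 4 - 6465848655 /
      16777216 * β ^ 3 - 25404162361 / 33554432 * β ^ 2 + 9025509117 / 16777216 * β + 6504882661
      / 33554432) * hβ
  have hη3 : (121 / 4 * β ^ 3 + 409 / 8 * β ^ 2 - 485 / 8 * β - 107 / 4) * (2 * (65667 / 16384 *
    β ^ 3 + 360925 / 65536 * β ^ 2 - 985157 / 131072 * β - 329407 / 131072) + (1 - c) * (-871 /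
    128 * β ^ 3 - 4985 / 512 * β ^ 2 + 12481 / 1024 * β + 4979 / 1024) - b) = 1 := by
    rw [hb, hc]
    linear_combination (-14649349 / 65536 * β ^ 5 - 156740189 / 262144 * β ^ 4 + 9825445 / 16384
      * β ^ 3 + 1621306911 / 1048576 * β ^ 2 - 430651989 / 524288 * β - 533340977 / 1048576) * hβ
  have hb0 : b ≠ 0 := by simpa using right_ne_zero_of_mul_eq_one hη0
  have h0 : (tateNormalForm b c).toAffine.Nonsingular 0 0 := by
    rw [nonsingular_zero]
    simpa [tateNormalForm] using hb0
  obtain ⟨h1, hP1⟩ := tateNormalForm_add_self (h := h0)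
    (ℓ := 0)
    (x' := b)
    (y' := -172433 / 131072 * β ^ 3 - 1971855 / 524288 * β ^ 2 - 2112121 / 1048576 * β + 120037 /
      1048576)
    (right_ne_zero_of_mul_eq_one hη0)
    (by ring) (by ring)
    (by
      rw [hb, hc]
      linear_combination (-959239 / 131072 * β ^ 2 - 4041345 / 524288 * β + 17120021 / 1048576) *
        hβ)
  obtain ⟨h2, hP2⟩ := tateNormalForm_add_self (h := h1)
    (ℓ := -221 / 16 * β ^ 3 - 1219 / 64 * β ^ 2 + 3419 / 128 * β + 1313 / 128)
    (x' := -1495 / 512 * β ^ 3 - 7945 / 2048 * β ^ 2 + 24785 / 4096 * β + 9891 / 4096)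
    (y' := -187961 / 65536 * β ^ 3 - 941799 / 262144 * β ^ 2 + 3437727 / 524288 * β + 1437357 /
      524288)
    (right_ne_zero_of_mul_eq_one hη1)
    (by
      rw [hb, hc]
      linear_combination (211991819 / 2097152 * β ^ 5 + 1031224793 / 4194304 * β ^ 4 - 9199926009
        / 33554432 * β ^ 3 - 20024509883 / 33554432 * β ^ 2 + 47265147701 / 134217728 * β +
        24000600629 / 134217728) * hβ)
    (by
      rw [hb, hc]
      linear_combination (-9061 / 1024 * β ^ 2 - 41139 / 4096 * β + 157487 / 8192) * hβ)
    (by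
      rw [hb, hc]
      linear_combination (-1279941 / 131072 * β ^ 2 - 5819219 / 524288 * β + 21287759 / 1048576)
        * hβ)
  obtain ⟨h3, hP3⟩ := tateNormalForm_add_self (h := h2)
    (ℓ := 43 / 16 * β ^ 3 + 309 / 64 * β ^ 2 - 349 / 128 * β - 263 / 128)
    (x' := -871 / 128 * β ^ 3 - 4985 / 512 * β ^ 2 + 12481 / 1024 * β + 4979 / 1024)
    (y' := 65667 / 16384 * β ^ 3 + 360925 / 65536 * β ^ 2 - 985157 / 131072 * β - 329407 /
      131072)
    (right_ne_zero_of_mul_eq_one hη2)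
    (by
      rw [hb, hc]
      linear_combination (-8935615 / 1048576 * β ^ 5 - 47878165 / 2097152 * β ^ 4 + 287029685 /
        16777216 * β ^ 3 + 859833903 / 16777216 * β ^ 2 - 1192077185 / 67108864 * β - 579783809 /
        67108864) * hβ)
    (by
      rw [hb, hc]
      linear_combination (-3913 / 1024 * β ^ 2 - 22959 / 4096 * β + 46171 / 8192) * hβ)
    (by
      rw [hb, hc]
      linear_combination (-569803 / 65536 * β ^ 2 - 2439325 / 262144 * β + 9919585 / 524288) *
        hβ)
  obtain ⟨h4, hP4⟩ := tateNormalForm_add_self (h := h3)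
    (ℓ := -141 / 16 * β ^ 3 - 787 / 64 * β ^ 2 + 2091 / 128 * β + 785 / 128)
    (x' := 0)
    (y' := b)
    (right_ne_zero_of_mul_eq_one hη3)
    (by
      rw [hb, hc]
      linear_combination (17070729 / 262144 * β ^ 5 + 81262595 / 524288 * β ^ 4 - 770950755 /
        4194304 * β ^ 3 - 1615278617 / 4194304 * β ^ 2 + 3835184695 / 16777216 * β + 2038100279 /
        16777216) * hβ)
    (by
      rw [hb, hc]
      linear_combination (-141 / 1024 * β ^ 2 - 4171 / 4096 * β - 11865 / 8192) * hβ)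
    (by
      rw [hb, hc]
      linear_combination (-122811 / 16384 * β ^ 2 - 528685 / 65536 * β + 2118961 / 131072) * hβ)
  set P : (tateNormalForm b c).toAffine.Point := .some 0 0 h0
  have hneg : -P = .some 0 b h4 := by
    rw [Point.neg_some, Point.some.injEq]
    simp [negY, tateNormalForm]
  have h17 : 17 • P = 0 := by
    rw [show 17 • P = P + (P + P + (P + P) + (P + P + (P + P)) +
      (P + P + (P + P) + (P + P + (P + P)))) by abel, hP1, hP2, hP3, hP4, ← hneg, add_neg_cancel]
  have : Fact (Nat.Prime 17) := ⟨by norm_num⟩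
  exact ⟨P, addOrderOf_eq_prime h17 (Point.some_ne_zero h0)⟩

end Origin

section Reduction

/-- `β ↦ -(6901/1024) β³ - (41387/4096) β² + (91011/8192) β + 39449/8192`, with `i` for `1/2`. -/
def parameterB {R : Type*} [CommRing R] (i β : R) : R :=
  -6901 * i ^ 10 * β ^ 3 - 41387 * i ^ 12 * β ^ 2 + 91011 * i ^ 13 * β + 39449 * i ^ 13

/-- `β ↦ -(139/16) β³ - (725/64) β² + (2301/128) β + 871/128`, with `i` for `1/2`. -/
def parameterC {R : Type*} [CommRing R] (i β : R) : R :=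
  -139 * i ^ 4 * β ^ 3 - 725 * i ^ 6 * β ^ 2 + 2301 * i ^ 7 * β + 871 * i ^ 7

lemma map_parameterB {R S : Type*} [CommRing R] [CommRing S] (f : R →+* S) (i β : R) :
    f (parameterB i β) = parameterB (f i) (f β) := by
  simp only [parameterB, map_add, map_sub, map_mul, map_neg, map_pow, map_ofNat]

lemma map_parameterC {R S : Type*} [CommRing R] [CommRing S] (f : R →+* S) (i β : R) :
    f (parameterC i β) = parameterC (f i) (f β) := by
  simp only [parameterC, map_add, map_sub, map_mul, map_neg, map_pow, map_ofNat]

lemma map_le_one_of_quartic {F : Type*} [Field F] {v : AbsoluteValue F ℝ} (hv : IsNonarchimedean v)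
    (hv2 : v 2 = 1) {β : F} (hβ : 8 * β ^ 4 + 14 * β ^ 3 - 11 * β ^ 2 - 11 * β - 2 = 0) :
    v β ≤ 1 := by
  by_contra! h
  have h0 : β ≠ 0 := by
    rintro rfl
    rw [v.map_zero] at h
    exact absurd h (by norm_num)
  have hi : v β⁻¹ ≤ 1 := by
    rw [map_inv₀]
    exact inv_le_one_of_one_le₀ h.le
  have h8 : v (2 * (2 * (2 * β))) = v β := by simp only [v.map_mul, hv2, one_mul]
  have hn (n : ℕ) [n.AtLeastTwo] := hv.map_ofNat_le_one n
  have hle : v (β⁻¹ * (11 + β⁻¹ * (11 + β⁻¹ * 2)) - 14) ≤ 1 :=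
    hv.map_sub_le_of_le (v.map_mul_le_of_le_one hi (hv.map_add_le_of_le (hn 11)
      (v.map_mul_le_of_le_one hi (hv.map_add_le_of_le (hn 11)
        (v.map_mul_le_of_le_one hi (hn 2)))))) (hn 14)
  rw [show β⁻¹ * (11 + β⁻¹ * (11 + β⁻¹ * 2)) - 14 = 2 * (2 * (2 * β)) by
    field_simp
    linear_combination -hβ, h8] at hle
  exact absurd h (not_lt.2 hle)

variable {K : Type*} [Field K] [CharZero K] {p : ℕ} [Fact p.Prime]

lemma exists_padicIntegers_parameters (hp : p ≠ 2) (φ : K →+* ℚ_[p]) {β b c : K}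
    (hβ : 8 * β ^ 4 + 14 * β ^ 3 - 11 * β ^ 2 - 11 * β - 2 = 0)
    (hb : b = -(6901 / 1024) * β ^ 3 - (41387 / 4096) * β ^ 2 + (91011 / 8192) * β + 39449 / 8192)
    (hc : c = -(139 / 16) * β ^ 3 - (725 / 64) * β ^ 2 + (2301 / 128) * β + 871 / 128) :
    ∃ (b' c' : padicIntegers φ) (i r : ZMod p), (b' : K) = b ∧ (c' : K) = c ∧ 2 * i = 1 ∧
      8 * r ^ 4 + 14 * r ^ 3 - 11 * r ^ 2 - 11 * r - 2 = 0 ∧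
      padicResidue φ b' = parameterB i r ∧ padicResidue φ c' = parameterC i r := by
  have hv2 := padicAbsoluteValue_two φ hp
  let β' : padicIntegers φ :=
    ⟨β, map_le_one_of_quartic (isNonarchimedean_padicAbsoluteValue φ) hv2 hβ⟩
  let i' : padicIntegers φ := ⟨2⁻¹, by rw [mem_padicIntegers_iff, map_inv₀, hv2, inv_one]⟩
  have hi : 2 * i' = 1 := Subtype.ext (mul_inv_cancel₀ two_ne_zero)
  have hβ' : 8 * β' ^ 4 + 14 * β' ^ 3 - 11 * β' ^ 2 - 11 * β' - 2 = 0 := Subtype.ext hβ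
  refine ⟨parameterB i' β', parameterC i' β', padicResidue φ i', padicResidue φ β', ?_, ?_, ?_, ?_,
    map_parameterB _ _ _, map_parameterC _ _ _⟩
  · change (padicIntegers φ).subtype (parameterB i' β') = b
    rw [map_parameterB, hb]
    change parameterB 2⁻¹ β = _
    rw [parameterB]
    ring
  · change (padicIntegers φ).subtype (parameterC i' β') = c
    rw [map_parameterC, hc]
    change parameterC 2⁻¹ β = _
    rw [parameterC]
    ring
  · simpa only [map_mul, map_ofNat, map_one] using congrArg (padicResidue φ) hi
  · simpa only [map_add, map_sub, map_mul, map_pow, map_ofNat, map_zero] using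
      congrArg (padicResidue φ) hβ'

end Reduction

section Residues

lemma two_torsion_zmod_53 : ∀ r : ZMod 53,
    8 * r ^ 4 + 14 * r ^ 3 - 11 * r ^ 2 - 11 * r - 2 = 0 → ∀ i : ZMod 53, 2 * i = 1 → ∀ x,
      4 * x ^ 3 + ((1 - parameterC i r) ^ 2 - 4 * parameterB i r) * x ^ 2 -
      2 * (1 - parameterC i r) * parameterB i r * x + parameterB i r ^ 2 ≠ 0 := by
  decide +kernel

lemma card_zmod_53 : ∀ r : ZMod 53,
    8 * r ^ 4 + 14 * r ^ 3 - 11 * r ^ 2 - 11 * r - 2 = 0 → ∀ i : ZMod 53, 2 * i = 1 →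
      Fintype.card {w : ZMod 53 × ZMod 53 //
        w.2 * (w.2 + (1 - parameterC i r) * w.1 - parameterB i r) =
          w.1 * w.1 * (w.1 - parameterB i r)} ≤ 50 := by
  decide +kernel

lemma three_torsion_zmod_89 : ∀ r : ZMod 89,
    8 * r ^ 4 + 14 * r ^ 3 - 11 * r ^ 2 - 11 * r - 2 = 0 → ∀ i : ZMod 89, 2 * i = 1 → ∀ x,
      3 * x ^ 4 + ((1 - parameterC i r) ^ 2 - 4 * parameterB i r) * x ^ 3 -
      3 * (1 - parameterC i r) * parameterB i r * x ^ 2 + 3 * parameterB i r ^ 2 * x -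
      parameterB i r ^ 3 ≠ 0 := by
  decide +kernel

end Residues

section Embedding

open Polynomial IntermediateField

lemma nonempty_adjoin_ringHom_padic {p : ℕ} [Fact p.Prime] {s : Finset (ZMod p)}
    (hs : ∀ r ∈ s, 8 * r ^ 4 + 14 * r ^ 3 - 11 * r ^ 2 - 11 * r - 2 = 0 ∧
      32 * r ^ 3 + 42 * r ^ 2 - 22 * r - 11 ≠ 0) (hcard : 4 ≤ s.card) {β : ℂ}
    (hβ : 8 * β ^ 4 + 14 * β ^ 3 - 11 * β ^ 2 - 11 * β - 2 = 0) :
    Nonempty (ℚ⟮β⟯ →+* ℚ_[p]) := by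
  set f : ℤ[X] := 8 * X ^ 4 + 14 * X ^ 3 - 11 * X ^ 2 - 11 * X - 2 with hf
  have hdeg : f.natDegree = 4 := by
    rw [hf]
    compute_degree!
  have hf0 : f ≠ 0 := by
    intro h
    rw [h, natDegree_zero] at hdeg
    exact absurd hdeg (by norm_num)
  have hsplits : (f.map (Int.castRingHom ℚ_[p])).Splits := by
    refine splits_padic_of_simple_roots hf0 (s := s) (fun r hr => ?_) (hdeg ▸ hcard)
    obtain ⟨h0, h1⟩ := hs r hr
    refine ⟨by simpa [hf, map_ofNat] using h0, ?_⟩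
    convert h1 using 1
    simp [hf, map_ofNat]
    ring
  have hroot : aeval β (f.map (Int.castRingHom ℚ)) = 0 := by
    simpa [hf, map_ofNat] using hβ
  have hne : f.map (Int.castRingHom ℚ) ≠ 0 :=
    (Polynomial.map_ne_zero_iff (RingHom.injective_int _)).2 hf0
  have hβint : IsIntegral ℚ β := isAlgebraic_iff_isIntegral.1 ⟨_, hne, hroot⟩
  have hdvd := Polynomial.map_dvd (algebraMap ℚ ℚ_[p]) (minpoly.dvd ℚ β hroot)
  rw [Polynomial.map_map, RingHom.eq_intCast' (RingHom.comp _ _)] at hdvd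
  have hmap : f.map (Int.castRingHom ℚ_[p]) ≠ 0 :=
    (Polynomial.map_ne_zero_iff (RingHom.injective_int _)).2 hf0
  obtain ⟨φ⟩ := nonempty_algHom_adjoin_of_splits (F := ℚ) (K := ℚ_[p]) (S := {β})
    (by
      rintro x rfl
      exact ⟨hβint, hsplits.of_dvd hmap hdvd⟩)
  exact ⟨φ.toRingHom⟩

end Embedding

section Torsion

lemma nonempty_addEquiv_zmod_seventeen {G : Type*} [AddCommGroup G] [Finite G]
    (hcard : Nat.card G ≤ 51) (h17 : ∃ P : G, addOrderOf P = 17)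
    (htwo : ∀ P : G, P ≠ 0 → 2 • P ≠ 0) (hthree : ∀ P : G, P ≠ 0 → 3 • P ≠ 0) :
    Nonempty (G ≃+ ZMod 17) := by
  have hprime {q : ℕ} [Fact q.Prime] (hq : ∀ P : G, P ≠ 0 → q • P ≠ 0) : ¬ q ∣ Nat.card G := by
    intro h
    obtain ⟨P, hP⟩ := exists_prime_addOrderOf_dvd_card' q h
    refine hq P ?_ (hP ▸ addOrderOf_nsmul_eq_zero P)
    rintro rfl
    rw [addOrderOf_zero] at hP
    exact (Fact.out : q.Prime).one_lt.ne hP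
  obtain ⟨P, hP⟩ := h17
  obtain ⟨k, hk⟩ : 17 ∣ Nat.card G := hP ▸ addOrderOf_dvd_natCard P
  have hpos : 0 < Nat.card G := Nat.card_pos
  have h2 := hprime htwo
  have h3 := hprime hthree
  have h : Nat.card G = 17 := by
    have : k ≤ 3 := by omega
    interval_cases k <;> omega
  have : Fact (Nat.Prime 17) := ⟨by norm_num⟩
  have hcyc : IsAddCyclic G := isAddCyclic_of_prime_card h
  exact ⟨(h ▸ zmodAddCyclicAddEquiv hcyc).symm⟩

variable {K : Type*} [Field K] [CharZero K] [DecidableEq K] {β b c : K}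

lemma tateNormalForm_torsion_card_le_of_zmod_53 [Fact (Nat.Prime 53)] (φ : K →+* ℚ_[53])
    (hβ : 8 * β ^ 4 + 14 * β ^ 3 - 11 * β ^ 2 - 11 * β - 2 = 0)
    (hb : b = -(6901 / 1024) * β ^ 3 - (41387 / 4096) * β ^ 2 + (91011 / 8192) * β + 39449 / 8192)
    (hc : c = -(139 / 16) * β ^ 3 - (725 / 64) * β ^ 2 + (2301 / 128) * β + 871 / 128) :
    Finite (AddCommGroup.torsion (tateNormalForm b c).toAffine.Point) ∧
      Nat.card (AddCommGroup.torsion (tateNormalForm b c).toAffine.Point) ≤ 51 ∧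
      ∀ P : (tateNormalForm b c).toAffine.Point, P ≠ 0 → 2 • P ≠ 0 := by
  have hp : 53 ≠ 2 := by norm_num
  obtain ⟨b', c', i, r, hb', hc', hi, hr, hbr, hcr⟩ :=
    exists_padicIntegers_parameters hp φ hβ hb hc
  clear hb hc
  subst hb' hc'
  have htwo (x y : ZMod 53)
      (he : (tateNormalForm (padicResidue φ b') (padicResidue φ c')).toAffine.Equation x y) :
      2 * y + (1 - padicResidue φ c') * x - padicResidue φ b' ≠ 0 := by
    rw [hbr, hcr] at he ⊢
    rw [tateNormalForm_equation_iff] at he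
    intro h
    refine two_torsion_zmod_53 r hr i hi x ?_
    linear_combination -4 * he +
      (2 * y + (1 - parameterC i r) * x - parameterB i r) * h
  obtain ⟨hfin, hle⟩ := tateNormalForm_torsion_card_le hp htwo
  refine ⟨hfin, hle.trans ?_, fun P => tateNormalForm_two_nsmul_ne_zero hp htwo⟩
  have hiff (w : ZMod 53 × ZMod 53) :
      (tateNormalForm (parameterB i r) (parameterC i r)).toAffine.Equation w.1 w.2 ↔
        w.2 * (w.2 + (1 - parameterC i r) * w.1 - parameterB i r) =
          w.1 * w.1 * (w.1 - parameterB i r) := by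
    rw [tateNormalForm_equation_iff]
    ring_nf
  rw [hbr, hcr, Nat.card_congr (Equiv.subtypeEquivRight hiff), Nat.card_eq_fintype_card]
  exact Nat.succ_le_succ (card_zmod_53 r hr i hi)

lemma tateNormalForm_three_nsmul_ne_zero_of_zmod_89 [Fact (Nat.Prime 89)] (φ : K →+* ℚ_[89])
    (hβ : 8 * β ^ 4 + 14 * β ^ 3 - 11 * β ^ 2 - 11 * β - 2 = 0)
    (hb : b = -(6901 / 1024) * β ^ 3 - (41387 / 4096) * β ^ 2 + (91011 / 8192) * β + 39449 / 8192)
    (hc : c = -(139 / 16) * β ^ 3 - (725 / 64) * β ^ 2 + (2301 / 128) * β + 871 / 128)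
    {P : (tateNormalForm b c).toAffine.Point} (hP : P ≠ 0) : 3 • P ≠ 0 := by
  have hp : 89 ≠ 2 := by norm_num
  obtain ⟨b', c', i, r, hb', hc', hi, hr, hbr, hcr⟩ :=
    exists_padicIntegers_parameters hp φ hβ hb hc
  clear hb hc
  subst hb' hc'
  refine tateNormalForm_three_nsmul_ne_zero hp (fun x => ?_) hP
  rw [hbr, hcr]
  exact three_torsion_zmod_89 r hr i hi x

end Torsion

/-- Let `β ∈ ℂ` be a root of `8x⁴ + 14x³ - 11x² - 11x - 2` and `K = ℚ(β)`.
With `b₂ = -(6901/1024)β³ - (41387/4096)β² + (91011/8192)β + 39449/8192` and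
`c₂ = -(139/16)β³ - (725/64)β² + (2301/128)β + 871/128`, let `W` be the Tate normal form
`E(b₂,c₂)` over `K`. Then the torsion subgroup of the group of `K`-rational points of `W` is
isomorphic to `ℤ/17ℤ`. -/
theorem tate_normal_form_torsion_seventeen_beta
    (β : ℂ) (hβ : 8 * β ^ 4 + 14 * β ^ 3 - 11 * β ^ 2 - 11 * β - 2 = 0)
    (K : IntermediateField ℚ ℂ) (hK : K = ℚ⟮β⟯)
    (b₂ c₂ : K)
    (hb₂ : (b₂ : ℂ) = -(6901 / 1024) * β ^ 3 - (41387 / 4096) * β ^ 2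
      + (91011 / 8192) * β + 39449 / 8192)
    (hc₂ : (c₂ : ℂ) = -(139 / 16) * β ^ 3 - (725 / 64) * β ^ 2
      + (2301 / 128) * β + 871 / 128)
    (W : WeierstrassCurve.Affine K)
    (hW : W = { a₁ := 1 - c₂, a₂ := -b₂, a₃ := -b₂, a₄ := 0, a₆ := 0 }) :
    Nonempty (AddCommGroup.torsion W.Point ≃+ ZMod 17) := by
  subst hK hW
  have h53 : ∀ r ∈ ({12, 19, 21, 39} : Finset (ZMod 53)),
      8 * r ^ 4 + 14 * r ^ 3 - 11 * r ^ 2 - 11 * r - 2 = 0 ∧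
      32 * r ^ 3 + 42 * r ^ 2 - 22 * r - 11 ≠ 0 := by decide
  have h89 : ∀ r ∈ ({32, 37, 39, 46} : Finset (ZMod 89)),
      8 * r ^ 4 + 14 * r ^ 3 - 11 * r ^ 2 - 11 * r - 2 = 0 ∧
      32 * r ^ 3 + 42 * r ^ 2 - 22 * r - 11 ≠ 0 := by decide
  have : Fact (Nat.Prime 53) := ⟨by norm_num⟩
  have : Fact (Nat.Prime 89) := ⟨by norm_num⟩
  let γ : ℚ⟮β⟯ := IntermediateField.AdjoinSimple.gen ℚ β
  have hγ : 8 * γ ^ 4 + 14 * γ ^ 3 - 11 * γ ^ 2 - 11 * γ - 2 = 0 := Subtype.ext hβ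
  have hb : b₂ = -(6901 / 1024) * γ ^ 3 - (41387 / 4096) * γ ^ 2 + (91011 / 8192) * γ
      + 39449 / 8192 := Subtype.ext hb₂
  have hc : c₂ = -(139 / 16) * γ ^ 3 - (725 / 64) * γ ^ 2 + (2301 / 128) * γ + 871 / 128 :=
    Subtype.ext hc₂
  obtain ⟨φ⟩ := nonempty_adjoin_ringHom_padic h53 (by rfl) hβ
  obtain ⟨ψ⟩ := nonempty_adjoin_ringHom_padic h89 (by rfl) hβ
  change Nonempty (AddCommGroup.torsion (tateNormalForm b₂ c₂).toAffine.Point ≃+ ZMod 17)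
  obtain ⟨hfin, hcard, htwo⟩ := tateNormalForm_torsion_card_le_of_zmod_53 φ hγ hb hc
  obtain ⟨P, hP⟩ := tateNormalForm_addOrderOf_origin hγ hb hc
  have hPtor : P ∈ AddCommGroup.torsion (tateNormalForm b₂ c₂).toAffine.Point :=
    addOrderOf_pos_iff.1 (hP ▸ Nat.succ_pos 16)
  refine nonempty_addEquiv_zmod_seventeen hcard
    ⟨⟨P, hPtor⟩, (AddSubgroup.addOrderOf_mk P hPtor).trans hP⟩ (fun Q hQ h => ?_) (fun Q hQ h => ?_)
  · exact htwo Q (fun h0 => hQ (Subtype.ext h0)) (congrArg Subtype.val h)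
  · exact tateNormalForm_three_nsmul_ne_zero_of_zmod_89 ψ hγ hb hc
      (fun h0 => hQ (Subtype.ext h0)) (congrArg Subtype.val h)
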